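/- Self-attention is permutation equivariant: for every B ∈ ℝ^{M×D}, every permutation π of {1,…,M}, and all projection matrices W_Q, W_K, W_V ∈ ℝ^{D×D'}, one has Attention((π·B)·W_Q, (π·B)·W_K, (π·B)·W_V) = π·Attention(B·W_Q, B·W_K, B·W_V). -/

import Mathlib

open Matrix BigOperators

/-- Row-wise softmax of a real matrix. -/
noncomputable def rowSoftmax {m n : ℕ} (M : Matrix (Fin m) (Fin n) ℝ) :
    Matrix (Fin m) (Fin n) ℝ :=
  Matrix.of fun i j => Real.exp (M i j) / ∑ k, Real.exp (M i k)

/-- Attention operator: rowSoftmax (Q Kᵀ / √D) · V. -/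
noncomputable def attention {R₁ R₂ D : ℕ} (Q : Matrix (Fin R₁) (Fin D) ℝ)
    (K V : Matrix (Fin R₂) (Fin D) ℝ) : Matrix (Fin R₁) (Fin D) ℝ :=
  rowSoftmax ((Real.sqrt D)⁻¹ • (Q * Kᵀ)) * V

/-- Row permutation of a matrix: (π·M)_{ij} = M_{π(i), j}. -/
def permRows {m n : ℕ} (π : Equiv.Perm (Fin m)) (M : Matrix (Fin m) (Fin n) ℝ) :
    Matrix (Fin m) (Fin n) ℝ :=
  Matrix.of fun i j => M (π i) j

theorem permRows_mul {m n p : ℕ} (π : Equiv.Perm (Fin m)) (A : Matrix (Fin m) (Fin n) ℝ)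
    (W : Matrix (Fin n) (Fin p) ℝ) : permRows π A * W = permRows π (A * W) := by
  ext i j
  simp [permRows, Matrix.mul_apply]

/-- Attention is equivariant in the queries and invariant under a joint permutation of
keys and values. -/
theorem attention_permRows {R₁ R₂ D : ℕ} (σ : Equiv.Perm (Fin R₁)) (π : Equiv.Perm (Fin R₂))
    (Q : Matrix (Fin R₁) (Fin D) ℝ) (K V : Matrix (Fin R₂) (Fin D) ℝ) :
    attention (permRows σ Q) (permRows π K) (permRows π V) =
      permRows σ (attention Q K V) := by
  ext i j
  simp only [attention, rowSoftmax, permRows, Matrix.mul_apply, Matrix.of_apply,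
    Matrix.smul_apply, Matrix.transpose_apply]
  rw [Equiv.sum_comp π fun k => Real.exp ((Real.sqrt D)⁻¹ • ∑ l, Q (σ i) l * K k l)]
  exact Equiv.sum_comp π fun k =>
    Real.exp ((Real.sqrt D)⁻¹ • ∑ l, Q (σ i) l * K k l) /
      (∑ k', Real.exp ((Real.sqrt D)⁻¹ • ∑ l, Q (σ i) l * K k' l)) * V k j

theorem selfAttention_perm_equivariant {M D D' : ℕ} (hD' : 0 < D')
    (B : Matrix (Fin M) (Fin D) ℝ) (π : Equiv.Perm (Fin M))
    (WQ : Matrix (Fin D) (Fin D') ℝ) (WK : Matrix (Fin D) (Fin D') ℝ)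
    (WV : Matrix (Fin D) (Fin D') ℝ) :
    attention (permRows π B * WQ) (permRows π B * WK) (permRows π B * WV) =
      permRows π (attention (B * WQ) (B * WK) (B * WV)) := by
  simp only [permRows_mul, attention_permRows]
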